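/- Let E be a field of characteristic different from 2 such that every square-free polynomial in E[X] is square-reflexive. Then every valuation on E has 2-divisible value group; that is, for every valuation v on E and every a ∈ E^× there exists b ∈ E^× with v(a) = v(b²). -/

import Mathlib

open Polynomial

/-- `f` is square-reflexive over `E`. -/
def IsSquareReflexive {E : Type*} [Field E] (f : Polynomial E) : Prop :=
  Squarefree f ∧
  ∀ α : (Polynomial E ⧸ Ideal.span {f})ˣ,
    (∃ u : Eˣ, Algebra.norm E (α : Polynomial E ⧸ Ideal.span {f}) = (u : E) ^ 2 ∨
               Algebra.norm E (α : Polynomial E ⧸ Ideal.span {f}) = f.leadingCoeff * (u : E) ^ 2) →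
    ∃ g : Polynomial E, IsCoprime f g ∧
      (∃ β : (Polynomial E ⧸ Ideal.span {f})ˣ,
        Ideal.Quotient.mk (Ideal.span {f}) g
          = (α : Polynomial E ⧸ Ideal.span {f}) * (β : Polynomial E ⧸ Ideal.span {f}) ^ 2) ∧
      IsSquare (Ideal.Quotient.mk (Ideal.span {g}) f)


section
set_option linter.unusedSimpArgs false
variable {E : Type*} [Field E] {Γ₀ : Type*} [LinearOrderedCommGroupWithZero Γ₀]

def SqV (v : Valuation E Γ₀) (x : E) : Prop := ∃ e : E, e ≠ 0 ∧ v x = v e ^ 2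

theorem SqV.mul {v : Valuation E Γ₀} {x y : E} (hx : SqV v x) (hy : SqV v y) : SqV v (x*y) := by
  obtain ⟨e, he, h⟩ := hx
  obtain ⟨d, hd, h'⟩ := hy
  exact ⟨e*d, mul_ne_zero he hd, by rw [map_mul, map_mul, h, h', mul_pow]⟩

theorem SqV.cancel {v : Valuation E Γ₀} {x y : E} (hx : SqV v (x*y)) (hy : SqV v y) : SqV v x := by
  obtain ⟨e, he, h⟩ := hx
  obtain ⟨d, hd, h'⟩ := hy
  refine ⟨e/d, div_ne_zero he hd, ?_⟩
  have h0 : v d ≠ 0 := by simpa using hd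
  rw [map_div₀, div_pow, ← h, eq_div_iff (pow_ne_zero _ h0), ← h', map_mul]

theorem SqV.sq (v : Valuation E Γ₀) {x : E} (hx : x ≠ 0) : SqV v (x*x) :=
  ⟨x, hx, by rw [map_mul, _root_.sq]⟩

theorem SqV.congr {v : Valuation E Γ₀} {x y : E} (hx : SqV v x) (h : v x = v y) : SqV v y := by
  obtain ⟨e, he, h'⟩ := hx
  exact ⟨e, he, h ▸ h'⟩

theorem SqV.one {v : Valuation E Γ₀} {x : E} (hx : v x = 1) : SqV v x :=
  ⟨1, one_ne_zero, by simp [hx]⟩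

def Pred (v : Valuation E Γ₀) (a : E) (g : E[X]) : Prop :=
  g.eval 0 ≠ 0 ∧ g.eval 1 ≠ 0 ∧ g.eval a ≠ 0 ∧
  (∃ h : E[X], g ∣ h ^ 2 - X * (X - C 1) * (X - C a)) ∧
  SqV v (a * g.eval 1) ∧ SqV v (a * (g.eval 0 * g.eval a))

theorem natDegree_f (a : E) : (X * (X - C 1) * (X - C a) : E[X]).natDegree = 3 := by
  have h1 : (X - C (1:E)) ≠ 0 := X_sub_C_ne_zero _
  have h2 : (X - C a) ≠ 0 := X_sub_C_ne_zero _
  rw [natDegree_mul (mul_ne_zero X_ne_zero h1) h2, natDegree_mul X_ne_zero h1,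
    natDegree_X_sub_C, natDegree_X_sub_C, natDegree_X]

theorem base0 (v : Valuation E Γ₀) (a : E) (hna : ¬ SqV v a) (g : E[X]) (hP : Pred v a g)
    (hd : g.natDegree = 0) : False := by
  obtain ⟨e, rfl⟩ := natDegree_eq_zero.1 hd
  obtain ⟨h0, h1, ha, -, hA, hB⟩ := hP
  simp only [eval_C] at *
  exact hna (hB.cancel (SqV.sq v h0))

theorem base1 (v : Valuation E Γ₀) (a : E) (hva : v a < 1) (hna : ¬ SqV v a) (g : E[X])
    (hP : Pred v a g) (hd : g.natDegree = 1) : False := by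
  obtain ⟨e, he, c, rfl⟩ := natDegree_eq_one.1 hd
  obtain ⟨r, rfl⟩ : ∃ r, c = - (e * r) := ⟨-c/e, by field_simp⟩
  obtain ⟨h0, h1, ha, ⟨h, k, hk⟩, hA, hB⟩ := hP
  have hr := congrArg (eval r) hk
  simp at h0 h1 ha hA hB hr
  have hr0 : r ≠ 0 := by tauto
  have hr1 : r - 1 ≠ 0 := by
    intro hh; apply h1; rw [sub_eq_zero.1 hh]; ring
  have hra : r - a ≠ 0 := by
    intro hh; apply ha; rw [sub_eq_zero.1 hh]; ring
  have hS : SqV v (r * (r-1) * (r-a)) := by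
    have : h.eval r ≠ 0 := by
      intro hh
      rw [hh] at hr
      have : r * (r-1) * (r-a) ≠ 0 := by positivity
      apply this
      linear_combination -hr
    have h2 := SqV.sq v this
    have e2 : eval r h * eval r h = r * (r-1) * (r-a) := by linear_combination hr
    rwa [e2] at h2
  have hB' : SqV v (a * (r * (r - a))) := by
    have : SqV v ((a * (r * (r - a))) * (e * e)) := by
      convert hB using 1; ring
    exact this.cancel (SqV.sq v he)
  rcases lt_trichotomy (v r) 1 with hlt | heq | hgt
  · have h1 : v (r - 1) = 1 := by
      rw [Valuation.map_sub_swap]; exact Valuation.map_one_sub_of_lt v hlt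
    apply hna
    have := (hB'.mul hS)
    have h3 : SqV v (a * (r-1) * ((r * (r-a)) * (r * (r-a)))) := by
      convert this using 1; ring
    exact (h3.cancel (SqV.sq v (mul_ne_zero hr0 hra))).cancel (SqV.one h1)
  · have h1 : v (r - a) = 1 := by
      rw [← heq]; exact Valuation.map_sub_eq_of_lt_left v (by rw [heq]; exact hva)
    exact hna (hB'.cancel (SqV.one (by simp [heq, h1])))
  · have h1 : v (r - a) = v r := 
      Valuation.map_sub_eq_of_lt_left v (hva.trans hgt)
    refine hna (SqV.cancel (y := r * r) (hB'.congr ?_) (SqV.sq v hr0))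
    simp [h1]

theorem split1 (h : E[X]) (x : E) : ∃ p q : E[X], (p = X - C x ∧ q = 1 ∧ h.eval x = 0) ∨
    (p = 1 ∧ q = X - C x ∧ h.eval x ≠ 0) := by
  by_cases hh : h.eval x = 0
  · exact ⟨_, _, Or.inl ⟨rfl, rfl, hh⟩⟩
  · exact ⟨_, _, Or.inr ⟨rfl, rfl, hh⟩⟩

theorem step (v : Valuation E Γ₀) (a : E) (ha0 : a ≠ 0) (hva : v a < 1) (g : E[X])
    (hP : Pred v a g) (hd : 2 ≤ g.natDegree) : ∃ k, Pred v a k ∧ k.natDegree < g.natDegree := by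
  obtain ⟨h0, h1, ha, ⟨h₁, hdiv⟩, hA, hB⟩ := hP
  have hg0 : g ≠ 0 := by rintro rfl; simp at hd
  obtain ⟨h, hh, hhd⟩ : ∃ h : E[X], g ∣ h ^ 2 - X * (X - C 1) * (X - C a) ∧
      h.natDegree < g.natDegree := by
    refine ⟨h₁ % g, ?_, natDegree_mod_lt _ (by omega)⟩
    have h2 : g ∣ h₁ - h₁ % g := ⟨h₁ / g, by
      have := EuclideanDomain.div_add_mod h₁ g
      linear_combination -this⟩
    have := dvd_sub hdiv (h2.mul_right (h₁ + h₁ % g))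
    convert this using 1; ring
  obtain ⟨k, hk⟩ := hh
  have hkd : k.natDegree < g.natDegree := by
    by_cases hk0 : k = 0
    · simp [hk0]; omega
    have e1 : (h ^ 2 - X * (X - C 1) * (X - C a)).natDegree = g.natDegree + k.natDegree := by
      rw [hk, natDegree_mul hg0 hk0]
    have e2 := natDegree_sub_le (h ^ 2) (X * (X - C 1) * (X - C a))
    rw [natDegree_f, natDegree_pow] at e2
    rcases le_max_iff.1 e2 with h | h <;> omega
  have ha1 : v (a - 1) = 1 := by
    rw [Valuation.map_sub_swap]; exact Valuation.map_one_sub_of_lt v hva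
  have ha1' : v (1 - a) = 1 := Valuation.map_one_sub_of_lt v hva
  have ha1n : a - 1 ≠ 0 := by intro h; simp [h] at ha1
  have ha1n' : 1 - a ≠ 0 := by intro h; simp [h] at ha1'
  have key : ∀ p q h' k' : E[X], h = p * h' → k = p * k' → p ≠ 0 →
      p * q = X * (X - C 1) * (X - C a) → g * k' = p * h' ^ 2 - q := by
    intro p q h' k' e1 e2 e3 e4
    apply mul_left_cancel₀ e3
    rw [e1, e2, ← e4] at hk
    linear_combination -hk
  obtain ⟨p0, q0, c0⟩ := split1 h 0
  obtain ⟨p1, q1, c1⟩ := split1 h 1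
  obtain ⟨pa, qa, ca⟩ := split1 h a
  have hpq : (p0 * p1 * pa) * (q0 * q1 * qa) = X * (X - C 1) * (X - C a) := by
    rcases c0 with ⟨rfl, rfl, -⟩ | ⟨rfl, rfl, -⟩ <;> rcases c1 with ⟨rfl, rfl, -⟩ | ⟨rfl, rfl, -⟩ <;>
    rcases ca with ⟨rfl, rfl, -⟩ | ⟨rfl, rfl, -⟩ <;> simp <;> ring
  have cop : ∀ x y : E, x - y ≠ 0 → IsCoprime (X - C x) (X - C y) := fun x y hxy =>
    isCoprime_X_sub_C_of_isUnit_sub (isUnit_iff_ne_zero.2 hxy)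
  have dv : ∀ t : E[X], (h.eval 0 = 0 → t.eval 0 = 0) → (h.eval 1 = 0 → t.eval 1 = 0) →
      (h.eval a = 0 → t.eval a = 0) → p0 * p1 * pa ∣ t := by
    intro t t0 t1 ta
    have d0 : p0 ∣ t := by
      rcases c0 with ⟨rfl, rfl, hz⟩ | ⟨rfl, rfl, -⟩
      · exact dvd_iff_isRoot.2 (t0 hz)
      · exact one_dvd _
    have d1 : p1 ∣ t := by
      rcases c1 with ⟨rfl, rfl, hz⟩ | ⟨rfl, rfl, -⟩
      · exact dvd_iff_isRoot.2 (t1 hz)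
      · exact one_dvd _
    have da : pa ∣ t := by
      rcases ca with ⟨rfl, rfl, hz⟩ | ⟨rfl, rfl, -⟩
      · exact dvd_iff_isRoot.2 (ta hz)
      · exact one_dvd _
    have c01 : IsCoprime p0 p1 := by
      rcases c0 with ⟨rfl, rfl, -⟩ | ⟨rfl, rfl, -⟩
      · rcases c1 with ⟨rfl, rfl, -⟩ | ⟨rfl, rfl, -⟩
        · exact cop _ _ (by simp)
        · exact isCoprime_one_right
      · exact isCoprime_one_left
    have c0a : IsCoprime p0 pa := by
      rcases c0 with ⟨rfl, rfl, -⟩ | ⟨rfl, rfl, -⟩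
      · rcases ca with ⟨rfl, rfl, -⟩ | ⟨rfl, rfl, -⟩
        · exact cop _ _ (by simpa using ha0)
        · exact isCoprime_one_right
      · exact isCoprime_one_left
    have c1a : IsCoprime p1 pa := by
      rcases c1 with ⟨rfl, rfl, -⟩ | ⟨rfl, rfl, -⟩
      · rcases ca with ⟨rfl, rfl, -⟩ | ⟨rfl, rfl, -⟩
        · exact cop _ _ ha1n'
        · exact isCoprime_one_right
      · exact isCoprime_one_left
    exact (c0a.mul_left c1a).mul_dvd (c01.mul_dvd d0 d1) da
  have kz : ∀ x, g.eval x ≠ 0 → x * (x - 1) * (x - a) = 0 → h.eval x = 0 → k.eval x = 0 := by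
    intro x hx hz hhx
    have := congrArg (eval x) hk
    simp only [eval_sub, eval_pow, eval_mul, eval_X, eval_C, hhx, hz] at this
    have h2 : g.eval x * k.eval x = 0 := by rw [← this]; ring
    exact (mul_eq_zero.1 h2).resolve_left hx
  obtain ⟨h', hh'⟩ := dv h id id id
  obtain ⟨k', hk'⟩ := dv k (kz 0 h0 (by simp)) (kz 1 h1 (by simp)) (kz a ha (by simp))
  have hpne : p0 * p1 * pa ≠ 0 := by
    intro hz
    rw [hz, zero_mul] at hpq
    have := natDegree_f a
    rw [← hpq] at this; simp at this
  have hkey := key _ _ _ _ hh' hk' hpne hpq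
  have E0 := congrArg (eval 0) hkey
  have E1 := congrArg (eval 1) hkey
  have Ea := congrArg (eval a) hkey
  have F0 := congrArg (eval 0) hh'
  have F1 := congrArg (eval 1) hh'
  have Fa := congrArg (eval a) hh'
  have main : (g.eval 0 * k'.eval 0 ≠ 0) ∧ (g.eval 1 * k'.eval 1 ≠ 0) ∧ (g.eval a * k'.eval a ≠ 0)
      ∧ SqV v (g.eval 1 * k'.eval 1) ∧
      SqV v ((g.eval 0 * k'.eval 0) * (g.eval a * k'.eval a)) := by
    rw [eval_mul] at E0 E1 Ea
    rw [E0, E1, Ea]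
    have y0 : h.eval 0 ≠ 0 → h'.eval 0 ≠ 0 := by
      intro hz; rw [F0, eval_mul] at hz; exact right_ne_zero_of_mul hz
    have y1 : h.eval 1 ≠ 0 → h'.eval 1 ≠ 0 := by
      intro hz; rw [F1, eval_mul] at hz; exact right_ne_zero_of_mul hz
    have ya : h.eval a ≠ 0 → h'.eval a ≠ 0 := by
      intro hz; rw [Fa, eval_mul] at hz; exact right_ne_zero_of_mul hz
    clear F0 F1 Fa
    clear E0 E1 Ea hkey hk' kz dv hk key hkd
    rcases c0 with ⟨rfl, rfl, z0⟩ | ⟨rfl, rfl, z0⟩ <;> rcases c1 with ⟨rfl, rfl, z1⟩ | ⟨rfl, rfl, z1⟩ <;>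
    rcases ca with ⟨rfl, rfl, za⟩ | ⟨rfl, rfl, za⟩ <;> 
    simp only [z0, z1, za, not_true_eq_false, not_false_eq_true, ne_eq, forall_const] at y0 y1 ya <;>
    (refine ⟨?_, ?_, ?_, ?_, ?_⟩
     · simp [ha0, ha1n, ha1n', y0, y1, ya]
     · simp [ha0, ha1n, ha1n', y0, y1, ya]
     · simp [ha0, ha1n, ha1n', y0, y1, ya]
     · first
       | (refine ⟨1, one_ne_zero, ?_⟩; simp [ha1, ha1']; done)
       | (refine ⟨_, y1, ?_⟩; simp [ha1, ha1']; done)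
     · first
       | (refine ⟨1, one_ne_zero, ?_⟩; simp [ha1, ha1']; done)
       | (refine ⟨a, ha0, ?_⟩; simp [ha1, ha1', pow_two]; done)
       | (refine ⟨_, mul_ne_zero y0 ya, ?_⟩; simp [ha1, ha1', mul_pow]; done)
       | (refine ⟨_, mul_ne_zero ha0 ya, ?_⟩; simp [ha1, ha1', pow_two, mul_assoc, mul_left_comm, mul_comm]; done)
       | (refine ⟨_, mul_ne_zero ha0 y0, ?_⟩; simp [ha1, ha1', pow_two, mul_assoc, mul_left_comm, mul_comm]; done))
  obtain ⟨m0, m1, ma, mA, mB⟩ := main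
  refine ⟨k', ⟨right_ne_zero_of_mul m0, right_ne_zero_of_mul m1, right_ne_zero_of_mul ma, 
    ⟨p0 * p1 * pa * h', ⟨p0 * p1 * pa * g, ?_⟩⟩, ?_, ?_⟩, ?_⟩
  · rw [← hpq]
    linear_combination -(p0 * p1 * pa) * hkey
  · have := hA.mul mA
    refine SqV.cancel (y := g.eval 1 * g.eval 1) ?_ (SqV.sq v h1)
    convert this using 1; ring
  · have := hB.mul mB
    refine SqV.cancel (y := (g.eval 0 * g.eval a) * (g.eval 0 * g.eval a)) ?_ (SqV.sq v (mul_ne_zero h0 ha))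
    convert this using 1; ring
  · have hk0 : k' ≠ 0 := by rintro rfl; simp at m0
    rw [hk', natDegree_mul hpne hk0] at hkd
    omega

theorem descent (v : Valuation E Γ₀) (a : E) (ha0 : a ≠ 0) (hva : v a < 1) (hna : ¬ SqV v a) :
    ∀ (n : ℕ) (g : E[X]), g.natDegree = n → ¬ Pred v a g := by
  intro n
  induction n using Nat.strong_induction_on with
  | _ n ih =>
    intro g hg hP
    rcases Nat.lt_or_ge n 2 with hn | hn
    · interval_cases n
      · exact base0 v a hna g hP hg
      · exact base1 v a hva hna g hP hg
    · obtain ⟨k, hk, hlt⟩ := step v a ha0 hva g hP (by omega)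
      exact ih _ (by omega) k rfl hk

theorem norm_pi3 (y : Fin 3 → E) : Algebra.norm E y = y 0 * y 1 * y 2 := by
  rw [Algebra.norm_eq_matrix_det (Pi.basisFun E (Fin 3))]
  have : Algebra.leftMulMatrix (Pi.basisFun E (Fin 3)) y = Matrix.diagonal y := by
    ext i j
    rw [Algebra.leftMulMatrix_eq_repr_mul]
    by_cases h : i = j
    · subst h; simp
    · simp [h, Matrix.diagonal]
  rw [this, Matrix.det_diagonal, Fin.prod_univ_three]

theorem exists_equiv (w : Fin 3 → E) (hw : Function.Injective w) (f : E[X])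
    (hf : f = ∏ i, (X - C (w i))) :
    ∃ e : (E[X] ⧸ Ideal.span {f}) ≃ₐ[E] (Fin 3 → E), 
      ∀ (g : E[X]) i, e (Ideal.Quotient.mk _ g) i = g.eval (w i) := by
  let φ : E[X] →ₐ[E] (Fin 3 → E) := Pi.algHom E _ fun i => aeval (w i)
  have hφ : ∀ g i, φ g i = g.eval (w i) := fun g i => by simp [φ, aeval_def, eval₂_eq_eval_map]
  have hker : ∀ g ∈ Ideal.span {f}, φ g = 0 := by
    intro g hg
    obtain ⟨k, rfl⟩ := Ideal.mem_span_singleton.1 hg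
    ext i
    rw [hφ, eval_mul, hf, eval_prod, Finset.prod_eq_zero (Finset.mem_univ i) (by simp)]
    simp
  let ψ := Ideal.Quotient.liftₐ (Ideal.span {f}) φ hker
  have hψ : ∀ g, ψ (Ideal.Quotient.mk _ g) = φ g := fun g => rfl
  have hb : Function.Bijective ψ := by
    constructor
    · rw [injective_iff_map_eq_zero]
      intro x hx
      obtain ⟨g, rfl⟩ := Ideal.Quotient.mk_surjective x
      rw [Ideal.Quotient.eq_zero_iff_mem, Ideal.mem_span_singleton, hf]
      refine Fintype.prod_dvd_of_coprime (pairwise_coprime_X_sub_C hw) fun i => ?_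
      rw [dvd_iff_isRoot, IsRoot.def, ← hφ, ← hψ, hx]; rfl
    · intro y
      refine ⟨Ideal.Quotient.mk _ (Lagrange.interpolate Finset.univ w y), ?_⟩
      ext i
      rw [hψ, hφ]
      exact Lagrange.eval_interpolate_at_node _ hw.injOn (Finset.mem_univ i)
  exact ⟨AlgEquiv.ofBijective ψ hb, fun g i => by
    rw [AlgEquiv.ofBijective_apply, hψ, hφ]⟩

theorem main_lt (hsr : ∀ f : Polynomial E, Squarefree f → IsSquareReflexive f)
    (v : Valuation E Γ₀) (a : E) (ha0 : a ≠ 0) (hva : v a < 1) : SqV v a := by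
  by_contra hna
  have ha1 : a ≠ 1 := by rintro rfl; simp at hva
  let w : Fin 3 → E := ![0, 1, a]
  have hw : Function.Injective w := by
    intro i j
    fin_cases i <;> fin_cases j <;> simp [w, ha0, ha1, ha0.symm, ha1.symm]
  set f : E[X] := X * (X - C 1) * (X - C a) with hfdef
  have hf : f = ∏ i, (X - C (w i)) := by
    rw [Fin.prod_univ_three]; simp [w, f]
  have hsq : Squarefree f := by
    rw [hf]; exact (separable_prod_X_sub_C_iff.2 hw).squarefree
  obtain ⟨e, he⟩ := exists_equiv w hw f hf
  let y : (Fin 3 → E)ˣ := MulEquiv.piUnits.symm ![Units.mk0 a ha0, Units.mk0 a ha0, 1]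
  have hy0 : (y : Fin 3 → E) 0 = a := rfl
  have hy1 : (y : Fin 3 → E) 1 = a := rfl
  have hy2 : (y : Fin 3 → E) 2 = 1 := rfl
  let α : (E[X] ⧸ Ideal.span {f})ˣ := Units.map (e.symm : _ →* _) y
  have hα : e (α : E[X] ⧸ Ideal.span {f}) = y := e.apply_symm_apply _
  obtain ⟨g, hcop, ⟨β, hβ⟩, ⟨s, hs⟩⟩ := (hsr f hsq).2 α ⟨Units.mk0 a ha0, Or.inl (by
    rw [← Algebra.norm_eq_of_algEquiv e, hα, norm_pi3, hy0, hy1, hy2]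
    simp [pow_two])⟩
  obtain ⟨h, rfl⟩ := Ideal.Quotient.mk_surjective s
  have hb : ∀ i, e (β : E[X] ⧸ Ideal.span {f}) i ≠ 0 := by
    intro i hi
    have h1 : e (β : E[X] ⧸ Ideal.span {f}) * e ((β⁻¹ : (E[X] ⧸ Ideal.span {f})ˣ) : E[X] ⧸ Ideal.span {f}) = 1 := by
      rw [← map_mul, Units.mul_inv, map_one]
    have h2 := congrFun h1 i
    rw [Pi.mul_apply, hi] at h2
    simp at h2
  have hv : ∀ i, g.eval (w i) = (y : Fin 3 → E) i * (e (β : E[X] ⧸ Ideal.span {f}) i * e (β : E[X] ⧸ Ideal.span {f}) i) := by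
    intro i
    rw [← he, hβ, map_mul, map_pow, hα]
    simp [pow_two]
  have v0 := hv 0
  have v1 := hv 1
  have v2 := hv 2
  rw [hy0] at v0
  rw [hy1] at v1
  rw [hy2] at v2
  have b0 := hb 0
  have b1 := hb 1
  have b2 := hb 2
  generalize e (β : E[X] ⧸ Ideal.span {f}) = b at *
  replace v0 : g.eval 0 = a * (b 0 * b 0) := v0
  replace v1 : g.eval 1 = a * (b 1 * b 1) := v1
  replace v2 : g.eval a = 1 * (b 2 * b 2) := v2
  refine descent v a ha0 hva hna _ g rfl ⟨?_, ?_, ?_, ⟨h, ?_⟩, ?_, ?_⟩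
  · rw [v0]; exact mul_ne_zero ha0 (mul_ne_zero b0 b0)
  · rw [v1]; exact mul_ne_zero ha0 (mul_ne_zero b1 b1)
  · rw [v2]; exact mul_ne_zero one_ne_zero (mul_ne_zero b2 b2)
  · rw [← map_mul, eq_comm, Ideal.Quotient.eq, Ideal.mem_span_singleton] at hs
    rwa [pow_two]
  · rw [v1]
    convert SqV.sq v (mul_ne_zero ha0 b1) using 1; ring
  · rw [v0, v2]
    convert SqV.sq v (mul_ne_zero (mul_ne_zero ha0 b0) b2) using 1; ring
end

/-- If every square-free polynomial over `E` is square-reflexive, then every valuation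
on `E` has 2-divisible value group. -/
theorem statement10 (E : Type*) [Field E] (hchar : ringChar E ≠ 2)
    (hsr : ∀ f : Polynomial E, Squarefree f → IsSquareReflexive f)
    (Γ₀ : Type*) [LinearOrderedCommGroupWithZero Γ₀] (v : Valuation E Γ₀)
    (a : Eˣ) :
    ∃ b : Eˣ, v (a : E) = v ((b : E) ^ 2) := by
  have key : SqV v (a : E) := by
    have ha0 : (a : E) ≠ 0 := a.ne_zero
    rcases lt_trichotomy (v (a : E)) 1 with h | h | h
    · exact main_lt hsr v a ha0 h
    · exact SqV.one h
    · have h1 : v ((a : E)⁻¹) < 1 := by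
        rw [map_inv₀]; exact inv_lt_one_of_one_lt₀ h
      have h2 := main_lt hsr v _ (inv_ne_zero ha0) h1
      refine SqV.cancel (y := (a : E)⁻¹) (SqV.one ?_) h2
      rw [mul_inv_cancel₀ ha0, map_one]
  obtain ⟨e, he, h⟩ := key
  exact ⟨Units.mk0 e he, by rw [h, map_pow]; rfl⟩
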